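/- arXiv:1812.06419 — 3 statements merged into one kernel-verified Lean document; each statement's English description precedes it below -/
import Mathlib

section
/- Let n ≥ 5 with n ≠ 6, and let N be a group of order n! that contains a subgroup isomorphic to the alternating group Aₙ. Then N is isomorphic to Sₙ or to Aₙ × C₂. -/
open Equiv Equiv.Perm

def cyc {X : Type*} [DecidableEq X] (a b c : X) : Perm X := swap a b * swap b c

theorem cyc_apply {X : Type*} [DecidableEq X] {a b c : X} (h1 : a ≠ b) (h2 : b ≠ c) (h3 : a ≠ c) (t : X) :
  cyc a b c t = if t = a then b else if t = b then c else if t = c then a else t := by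
  simp only [cyc, Perm.mul_apply, swap_apply_def]; grind

theorem exists_cyc {X : Type*} [DecidableEq X] [Fintype X] {x : Perm X} (h : x.IsThreeCycle) :
   ∃ a b c, a ≠ b ∧ b ≠ c ∧ a ≠ c ∧ x = cyc a b c := by
  obtain ⟨a, ha⟩ : ∃ a, a ∈ x.support := by
    rw [← Finset.Nonempty, ← Finset.card_pos, h.card_support]; norm_num
  have h1 := h.nodup_iff_mem_support.2 ha
  have h2 := h.eq_swap_mul_swap_iff_mem_support.2 ha
  exact ⟨a, x a, x (x a), by grind, by grind, by grind, h2⟩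

theorem isThree_cyc {X : Type*} [DecidableEq X] [Fintype X] {a b c : X} (h1 : a ≠ b) (h2 : b ≠ c) (h3 : a ≠ c) :
   (cyc a b c).IsThreeCycle := by
  rw [cyc, swap_comm]; exact isThreeCycle_swap_mul_swap_same h1.symm h2 h3 

theorem share {X : Type*} [DecidableEq X] {a b c d e f : X} (h1 : a ≠ b) (h2 : b ≠ c) (h3 : a ≠ c)
  (h4 : d ≠ e) (h5 : e ≠ f) (h6 : d ≠ f) (hne : cyc a b c * cyc d e f ≠ 1) 
  (h : (cyc a b c * cyc d e f)^2 = 1) : ∃ p, cyc a b c p = cyc d e f p ∧ cyc a b c p ≠ p := by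
  by_contra! H
  have key : ∀ t, cyc a b c (cyc d e f (cyc a b c (cyc d e f t))) = t := fun t => by
    rw [pow_two] at h
    exact congrArg (fun g : Perm X => g t) h
  have hn : ∃ t, cyc a b c (cyc d e f t) ≠ t := by
    by_contra! H; apply hne; ext t; exact H t
  obtain ⟨t, ht⟩ := hn
  have Ha := H a
  have Hb := H b
  have Hc := H c
  have ka := key a
  have kb := key b
  have kc := key c
  have kd := key d
  have ke := key e
  have kf := key f
  clear hne h key H
  simp only [cyc_apply h1 h2 h3, cyc_apply h4 h5 h6] at *
  grind

theorem cyc_cube {X : Type*} [DecidableEq X] {a b c : X} (h1 : a ≠ b) (h2 : b ≠ c) (h3 : a ≠ c) :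
   (cyc a b c)^3 = 1 := by
  have Pa : cyc a b c a = b := by rw [cyc_apply h1 h2 h3]; grind
  have Pb : cyc a b c b = c := by rw [cyc_apply h1 h2 h3]; grind
  have Pc : cyc a b c c = a := by rw [cyc_apply h1 h2 h3]; grind
  have Pt : ∀ t, t ≠ a → t ≠ b → t ≠ c → cyc a b c t = t := by
    intro t; rw [cyc_apply h1 h2 h3]; grind
  ext t
  simp only [pow_succ, pow_zero, one_mul, Perm.mul_apply, Perm.one_apply]
  by_cases t = a; · simp [*]
  by_cases t = b; · simp [*]
  by_cases t = c; · simp [*]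
  simp [*]

theorem prodord0 {X : Type*} [DecidableEq X] {a b c d e f : X} (h1 : a ≠ b) (h2 : b ≠ c) (h3 : a ≠ c)
  (h4 : d ≠ e) (h5 : e ≠ f) (h6 : d ≠ f) (h : ∀ x ∈ [a,b,c], x ∉ [d,e,f]): 
  (cyc a b c * cyc d e f)^3 = 1 := by
  have : Commute (cyc a b c) (cyc d e f) := by
    ext t
    simp at h
    simp only [Perm.mul_apply, cyc_apply h1 h2 h3, cyc_apply h4 h5 h6]
    grind
  rw [this.mul_pow, cyc_cube h1 h2 h3, cyc_cube h4 h5 h6, one_mul]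

theorem prodord1 {X : Type*} [DecidableEq X] {a b c e f : X} (h1 : a ≠ b) (h2 : b ≠ c) (h3 : a ≠ c)
  (h4 : a ≠ e) (h5 : e ≠ f) (h6 : a ≠ f) : 
  (cyc a b c * cyc a e f)^2 = 1 ∨ (cyc a b c * cyc a e f)^3 = 1 ∨ (cyc a b c * cyc a e f)^5 = 1 := by
  have hP : ∀ t, (cyc a b c * cyc a e f) t = 
     cyc a b c (if t = a then e else if t = e then f else if t = f then a else t) := fun t => by
    rw [Perm.mul_apply, cyc_apply h4 h5 h6]
  simp only [cyc_apply h1 h2 h3] at hP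
  generalize cyc a b c * cyc a e f = P at *
  have Pa := hP a
  have Pb := hP b
  have Pc := hP c
  have Pe := hP e
  have Pf := hP f
  have Pt : ∀ t, t ≠ a → t ≠ b → t ≠ c → t ≠ e → t ≠ f → P t = t := by
    intro t; have := hP t; grind
  clear hP
  have D : ∀ t, t = a ∨ t = b ∨ t = c ∨ t = e ∨ t = f ∨ P t = t := by
    intro t; have := Pt t; grind
  clear Pt
  have main : (∀ t, P (P t) = t) ∨ (∀ t, P (P (P t)) = t) ∨ ∀ t, P (P (P (P (P t)))) = t := by
    by_cases B : b = e <;> by_cases C : c = f <;> by_cases E : b = f <;> by_cases F : c = e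
    all_goals simp [h1, h2, h3, h4, h5, h6, h1.symm, h2.symm, h3.symm, h4.symm, h5.symm, h6.symm, B, C, E, F] at Pa Pb Pc Pe Pf
    all_goals first
    | (left; intro t; rcases D t with h | h | h | h | h | h <;> grind)
    | (right; left; intro t; rcases D t with h | h | h | h | h | h <;> grind)
    | (right; right; intro t; rcases D t with h | h | h | h | h | h <;> grind)
  rcases main with h | h | h
  · left; ext t; exact h t
  · right; left; ext t; exact h t
  · right; right; ext t; exact h t

theorem cyc_rot {X : Type*} [DecidableEq X] {a b c : X} (h1 : a ≠ b) (h2 : b ≠ c) (h3 : a ≠ c) : 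
  cyc a b c = cyc b c a := by
  ext t; simp only [cyc_apply h1 h2 h3, cyc_apply h2 h3.symm h1.symm]; grind

theorem prodord {X : Type*} [DecidableEq X] {a b c d e f : X} (h1 : a ≠ b) (h2 : b ≠ c) (h3 : a ≠ c)
  (h4 : d ≠ e) (h5 : e ≠ f) (h6 : d ≠ f) : 
  (cyc a b c * cyc d e f)^2 = 1 ∨ (cyc a b c * cyc d e f)^3 = 1 ∨ (cyc a b c * cyc d e f)^5 = 1 := by
  by_cases h : ∀ x ∈ [a,b,c], x ∉ [d,e,f]
  · exact Or.inr (Or.inl (prodord0 h1 h2 h3 h4 h5 h6 h))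
  have r1 := cyc_rot h1 h2 h3
  have r2 := cyc_rot h2 h3.symm h1.symm
  have s1 := cyc_rot h4 h5 h6
  have s2 := cyc_rot h5 h6.symm h4.symm
  have : ∃ b' c' e' f' a', cyc a b c = cyc a' b' c' ∧ cyc d e f = cyc a' e' f' ∧ a' ≠ b' ∧ b' ≠ c' ∧ a' ≠ c'
     ∧ a' ≠ e' ∧ e' ≠ f' ∧ a' ≠ f' := by
    push Not at h
    obtain ⟨x, hx, hy⟩ := h
    have A : ∃ b' c', cyc a b c = cyc x b' c' ∧ x ≠ b' ∧ b' ≠ c' ∧ x ≠ c' := by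
      simp only [List.mem_cons, List.not_mem_nil, or_false] at hx
      rcases hx with rfl | rfl | rfl
      · exact ⟨_, _, rfl, h1, h2, h3⟩
      · exact ⟨_, _, r1, h2, h3.symm, h1.symm⟩
      · exact ⟨_, _, r1.trans r2, h3.symm, h1, h2.symm⟩
    have B : ∃ b' c', cyc d e f = cyc x b' c' ∧ x ≠ b' ∧ b' ≠ c' ∧ x ≠ c' := by
      simp only [List.mem_cons, List.not_mem_nil, or_false] at hy
      rcases hy with rfl | rfl | rfl
      · exact ⟨_, _, rfl, h4, h5, h6⟩
      · exact ⟨_, _, s1, h5, h6.symm, h4.symm⟩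
      · exact ⟨_, _, s1.trans s2, h6.symm, h4, h5.symm⟩
    obtain ⟨b', c', p1, p2, p3, p4⟩ := A
    obtain ⟨e', f', q1, q2, q3, q4⟩ := B
    exact ⟨b', c', e', f', x, p1, q1, p2, p3, p4, q2, q3, q4⟩
  obtain ⟨b', c', e', f', a', e1, e2, k1, k2, k3, k4, k5, k6⟩ := this
  rw [e1, e2]
  exact prodord1 k1 k2 k3 k4 k5 k6

theorem share3 {X : Type*} [DecidableEq X] {a b c d e f g p q : X} (h1 : a ≠ b) (h2 : b ≠ c) (h3 : a ≠ c)
  (h4 : d ≠ b) (h5 : d ≠ a) (h6 : c ≠ d) (g1 : e ≠ f) (g2 : f ≠ g) (g3 : e ≠ g)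
  (hp : cyc a b c p = cyc e f g p) (hp' : cyc a b c p ≠ p) (hq : cyc a b d q = cyc e f g q) (hq' : cyc a b d q ≠ q) :
   cyc e f g a = b := by
  simp only [cyc_apply h1 h2 h3, cyc_apply h1 h4.symm h5.symm, cyc_apply g1 g2 g3] at *
  grind

theorem comm_ne {X : Type*} [DecidableEq X] (x : Perm X) {a b z : X} (hx : x^3 = 1) (ha : x a ≠ a)
   (hb : x b ≠ b) (hab : b ≠ a) (hab1 : b ≠ x a) (hab2 : b ≠ x (x a))
   (hz : z ∉ [a, x a, x (x a), b, x b, x (x b)]) (j : ℕ) (hj : j = 2 ∨ j = 3 ∨ j = 5) : 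
   (x * (swap a b * swap (x a) z) * x⁻¹ * (swap a b * swap (x a) z)⁻¹)^j ≠ 1 := by
  have h3 : ∀ t, x (x (x t)) = t := fun t => by
    have := congrArg (fun g : Perm X => g t) hx
    simpa [pow_succ] using this
  have conj : x * (swap a b * swap (x a) z) * x⁻¹ = swap (x a) (x b) * swap (x (x a)) (x z) := by
    rw [Equiv.swap_apply_apply x a b, Equiv.swap_apply_apply x (x a) z]; group
  rw [conj, mul_inv_rev, swap_inv, swap_inv]
  have inj := x.injective
  have i1 : x b ≠ x a := fun h => hab (inj h)
  have e2 : x a ≠ x (x a) := fun h => ha (inj h).symm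
  have e3 : a ≠ x (x a) := fun h => ha (by have := h3 a; rwa [← h] at this)
  have e4 : x b ≠ x (x b) := fun h => hb (inj h).symm
  have e5 : x b ≠ a := fun h => hab2 (by rw [← h, h3])
  have e6 : x b ≠ x (x a) := fun h => hab1 (inj h)
  have z1 : x z ≠ a := fun h => hz (by have := h3 z; rw [h] at this; simp [← this])
  have z2 : x z ≠ x a := fun h => hz (by rw [inj h]; simp)
  have z3 : x z ≠ x (x a) := fun h => hz (by rw [inj h]; simp)
  have z4 : x z ≠ b := fun h => hz (by have := h3 z; rw [h] at this; simp [← this])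
  have z5 : x z ≠ x b := fun h => hz (by rw [inj h]; simp)
  simp only [List.mem_cons, List.not_mem_nil, or_false, not_or] at hz
  obtain ⟨w1, w2, w3, w4, w5, w6⟩ := hz
  clear inj conj h3
  generalize x z = z' at *
  generalize x (x a) = a2 at *
  generalize x (x b) = b2 at *
  generalize x b = b1 at *
  generalize x a = a1 at *
  have hC : ∀ t, (swap a1 b1 * swap a2 z' * (swap a1 z * swap a b)) t = swap a1 b1 (swap a2 z' (swap a1 z (swap a b t))) := fun t => rfl
  generalize swap a1 b1 * swap a2 z' * (swap a1 z * swap a b) = C at *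
  intro h
  have H : ∀ t, (C^j) t = t := by
    intro t; rw [h]; rfl
  clear hx h
  by_cases hzz : z' = z
  · subst hzz
    have C1 : C a1 = a2 := by rw [hC]; simp only [swap_apply_def]; grind
    have C2 : C a2 = z' := by rw [hC]; simp only [swap_apply_def]; grind
    have C3 : C z' = b1 := by rw [hC]; simp only [swap_apply_def]; grind
    have C4 : C b1 = a1 := by rw [hC]; simp only [swap_apply_def]; grind
    have K := H a1
    rcases hj with rfl | rfl | rfl <;>
    simp only [pow_succ, pow_zero, one_mul, Perm.mul_apply, C1, C2, C3, C4] at K <;> grind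
  · have C1 : C a = b := by rw [hC]; simp only [swap_apply_def]; grind
    have C2 : C b = a := by rw [hC]; simp only [swap_apply_def]; grind
    have C3 : C a1 = z := by rw [hC]; simp only [swap_apply_def]; grind
    have C4 : C z = b1 := by rw [hC]; simp only [swap_apply_def]; grind
    have K := H a
    have K' := H a1
    rcases hj with rfl | rfl | rfl <;>
    simp only [pow_succ, pow_zero, one_mul, Perm.mul_apply, C1, C2, C3, C4] at K K' <;> grind

theorem three_conj {X : Type*} [DecidableEq X] [Fintype X] {x : Perm X} (h : x.IsThreeCycle) (s : Perm X) :
    (s * x * s⁻¹).IsThreeCycle := by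
  unfold IsThreeCycle at *; rw [cycleType_conj]; exact h

theorem three_fwd {X : Type*} [DecidableEq X] [Fintype X] {x : Perm X} (h : x.IsThreeCycle) (s : Perm X) :
    (x * s * x⁻¹ * s⁻¹)^2 = 1 ∨ (x * s * x⁻¹ * s⁻¹)^3 = 1 ∨ (x * s * x⁻¹ * s⁻¹)^5 = 1 := by
  obtain ⟨a, b, c, h1, h2, h3, e1⟩ := exists_cyc h
  obtain ⟨a', b', c', h1', h2', h3', e2⟩ := exists_cyc (three_conj h.inv s)
  have : x * s * x⁻¹ * s⁻¹ = cyc a b c * cyc a' b' c' := by rw [← e1, ← e2]; group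
  rw [this]
  exact prodord h1 h2 h3 h1' h2' h3'

theorem three_bwd {n : ℕ} (hn6 : n ≠ 6) {x : Perm (Fin n)} (h3 : x ^ 3 = 1) (h1 : x ≠ 1)
    (H : ∀ s ∈ alternatingGroup (Fin n), 
    (x * s * x⁻¹ * s⁻¹)^2 = 1 ∨ (x * s * x⁻¹ * s⁻¹)^3 = 1 ∨ (x * s * x⁻¹ * s⁻¹)^5 = 1) : x.IsThreeCycle := by
  have h3' : ∀ t, x (x (x t)) = t := fun t => by
    have := congrArg (fun g : Perm (Fin n) => g t) h3
    simpa [pow_succ] using this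
  have inj := x.injective
  obtain ⟨a, ha⟩ : ∃ a, x a ≠ a := by
    by_contra! h; apply h1; ext t; simp [h]
  have e2 : x a ≠ x (x a) := fun h => ha (inj h).symm
  have e3 : a ≠ x (x a) := fun h => ha (by have := h3' a; rwa [← h] at this)
  by_cases hb : ∃ b, x b ≠ b ∧ b ≠ a ∧ b ≠ x a ∧ b ≠ x (x a)
  · obtain ⟨b, hb, hab, hab1, hab2⟩ := hb
    have i1 : x b ≠ x a := fun h => hab (inj h)
    have e4 : x b ≠ x (x b) := fun h => hb (inj h).symm
    have e4' : b ≠ x (x b) := fun h => hb (by have := h3' b; rwa [← h] at this)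
    have e5 : x b ≠ a := fun h => hab2 (by rw [← h, h3'])
    have e6 : x b ≠ x (x a) := fun h => hab1 (inj h)
    have e7 : x (x b) ≠ x a := fun h => e5 (inj h)
    have e8 : x (x b) ≠ x (x a) := fun h => i1 (inj h)
    have e9 : x (x b) ≠ a := fun h => hab1 (by rw [← h, h3'])
    have nd : [a, x a, x (x a), b, x b, x (x b)].Nodup := by
      simp [*, ha.symm, hab.symm, hab1.symm, hab2.symm, hb.symm, i1.symm, e5.symm, e6.symm, e7.symm, e8.symm, e9.symm]
    obtain ⟨z, hz⟩ : ∃ z, z ∉ [a, x a, x (x a), b, x b, x (x b)] := by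
      by_contra! hall
      apply hn6
      have h := List.toFinset_card_of_nodup nd
      rw [Finset.eq_univ_of_forall (fun z => List.mem_toFinset.2 (hall z))] at h
      simpa using h
    exfalso
    have key := comm_ne x h3 ha hb hab hab1 hab2 hz
    have hz1 : x a ≠ z := by rintro rfl; simp at hz
    have hm : swap a b * swap (x a) z ∈ alternatingGroup (Fin n) := by
      rw [mem_alternatingGroup, Perm.sign_mul, sign_swap hab.symm, sign_swap hz1]; rfl
    rcases H _ hm with h | h | h
    · exact key 2 (by simp) h
    · exact key 3 (by simp) h
    · exact key 5 (by simp) h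
  · push Not at hb
    rw [← card_support_eq_three_iff]
    have : x.support = {a, x a, x (x a)} := by
      ext t
      simp only [mem_support, Finset.mem_insert, Finset.mem_singleton]
      constructor
      · intro ht; have := hb t ht; tauto
      · rintro (rfl | rfl | rfl)
        · exact ha
        · exact e2.symm
        · rw [h3']; exact e3
    rw [this]
    rw [Finset.card_eq_three]
    exact ⟨_, _, _, ha.symm, e3, e2, rfl⟩

theorem aut_three {n : ℕ} (hn6 : n ≠ 6) (α : MulAut (alternatingGroup (Fin n))) (x : alternatingGroup (Fin n))
    (hx : (x : Perm (Fin n)).IsThreeCycle) : (α x : Perm (Fin n)).IsThreeCycle := by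
  apply three_bwd hn6
  · have : x ^ 3 = 1 := by
      apply Subtype.ext
      have := hx.orderOf ▸ pow_orderOf_eq_one (x : Perm (Fin n))
      simpa using this
    have := congrArg α this
    rw [map_pow, map_one] at this
    simpa using congrArg Subtype.val this
  · intro h
    have h : α x = 1 := Subtype.ext h
    have : x = 1 := by simpa using h
    exact hx.ne_one (by rw [this]; rfl)
  · intro s hs
    have key : ∀ j : ℕ, ((x : Perm (Fin n)) * (α.symm ⟨s, hs⟩ : alternatingGroup (Fin n)) * (x : Perm (Fin n))⁻¹ * ((α.symm ⟨s, hs⟩ : alternatingGroup (Fin n)) : Perm (Fin n))⁻¹)^j = 1 → 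
      ((α x : Perm (Fin n)) * s * (α x : Perm (Fin n))⁻¹ * s⁻¹)^j = 1 := by
      intro j h
      have h' : (x * (α.symm ⟨s, hs⟩) * x⁻¹ * (α.symm ⟨s, hs⟩)⁻¹)^j = 1 := Subtype.ext (by simpa using h)
      have := congrArg α h'
      simp only [map_pow, map_mul, map_inv, map_one, MulEquiv.apply_symm_apply] at this
      simpa using congrArg Subtype.val this
    rcases three_fwd hx (α.symm ⟨s, hs⟩ : alternatingGroup (Fin n)) with h | h | h
    · exact Or.inl (key _ h)
    · exact Or.inr (Or.inl (key _ h))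
    · exact Or.inr (Or.inr (key _ h))

theorem cyc_conj {X : Type*} [DecidableEq X] (s : Perm X) (a b c : X) :
    s * cyc a b c * s⁻¹ = cyc (s a) (s b) (s c) := by
  unfold cyc
  rw [Equiv.swap_apply_apply s a b, Equiv.swap_apply_apply s b c]; group

/-- generation by 3-cycles through two points -/
theorem gen {n : ℕ} (G : Subgroup (Perm (Fin n))) (o l : Fin n) (hol : o ≠ l)
    (h : ∀ i, i ≠ o → i ≠ l → cyc o l i ∈ G) : alternatingGroup (Fin n) ≤ G := by
  have conj : ∀ s ∈ G, ∀ a b c, cyc a b c ∈ G → cyc (s a) (s b) (s c) ∈ G := by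
    intro s hs a b c habc
    rw [← cyc_conj]
    exact G.mul_mem (G.mul_mem hs habc) (G.inv_mem hs)
  have h2 : ∀ i j, i ≠ o → i ≠ l → j ≠ o → j ≠ l → i ≠ j → cyc l i j ∈ G := by
    intro i j hi hi' hj hj' hij
    have := conj _ (h i hi hi') _ _ _ (h j hj hj')
    simp only [cyc_apply hol hi'.symm hi.symm] at this
    simpa [hol.symm, hj, hj', hij.symm] using this
  have h3 : ∀ i j, i ≠ o → i ≠ l → j ≠ o → j ≠ l → i ≠ j → cyc o i j ∈ G := by
    intro i j hi hi' hj hj' hij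
    have := conj _ (G.inv_mem (h i hi hi')) _ _ _ (h j hj hj')
    have k1 : (cyc o l i)⁻¹ o = i := by
      rw [Perm.inv_eq_iff_eq, cyc_apply hol hi'.symm hi.symm]; simp [hi, hi']
    have k2 : (cyc o l i)⁻¹ l = o := by
      rw [Perm.inv_eq_iff_eq, cyc_apply hol hi'.symm hi.symm]; simp
    have k3 : (cyc o l i)⁻¹ j = j := by
      rw [Perm.inv_eq_iff_eq, cyc_apply hol hi'.symm hi.symm]; simp [hj, hj', hij.symm]
    rw [k1, k2, k3] at this
    have := G.inv_mem this
    have e : (cyc i o j)⁻¹ = cyc o i j := by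
      unfold cyc
      rw [mul_inv_rev, swap_inv, swap_inv]
      ext t
      simp only [Perm.mul_apply, swap_apply_def]
      grind
    rwa [e] at this
  have h4 : ∀ i j k, i ≠ o → i ≠ l → j ≠ o → j ≠ l → k ≠ o → k ≠ l → i ≠ j → j ≠ k → i ≠ k → cyc k i j ∈ G := by
    intro i j k hi hi' hj hj' hk hk' hij hjk hik
    have := conj _ (h k hk hk') _ _ _ (h2 i j hi hi' hj hj' hij)
    simp only [cyc_apply hol hk'.symm hk.symm] at this
    simpa [hol.symm, hi, hi', hj, hj', hik, hjk] using this
  have h5 : ∀ i, i ≠ o → i ≠ l → cyc l o i ∈ G := by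
    intro i hi hi'
    have := G.inv_mem (h i hi hi')
    have e : (cyc o l i)⁻¹ = cyc l o i := by
      unfold cyc
      rw [mul_inv_rev, swap_inv, swap_inv]
      ext t
      simp only [Perm.mul_apply, swap_apply_def]
      grind
    rwa [e] at this
  rw [← closure_three_cycles_eq_alternating, Subgroup.closure_le]
  intro x hx
  obtain ⟨a, b, c, hab, hbc, hac, rfl⟩ := exists_cyc hx
  show cyc a b c ∈ G
  have r1 := cyc_rot hab hbc hac
  have r2 := cyc_rot hbc hac.symm hab.symm
  by_cases ao : a = o <;> by_cases al : a = l <;> by_cases bo : b = o <;> by_cases bl : b = l <;>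
    by_cases co : c = o <;> by_cases cl : c = l <;> grind

theorem aut_inner {n : ℕ} (hn : 5 ≤ n) (hn6 : n ≠ 6) (α : MulAut (alternatingGroup (Fin n))) :
    ∃ s : Perm (Fin n), ∀ g, (α g : Perm (Fin n)) = s * g * s⁻¹ := by
  let o : Fin n := ⟨0, by omega⟩
  let l : Fin n := ⟨1, by omega⟩
  let m : Fin n := ⟨2, by omega⟩
  let k : Fin n := ⟨3, by omega⟩
  have hol : o ≠ l := by simp [o, l]
  have hmo : m ≠ o := by simp [o, m]
  have hml : m ≠ l := by simp [l, m]
  have hko : k ≠ o := by simp [o, k]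
  have hkl : k ≠ l := by simp [l, k]
  have hmk : m ≠ k := by simp [m, k]
  clear_value o l m k
  have memA : ∀ i, i ≠ o → i ≠ l → cyc o l i ∈ alternatingGroup (Fin n) := fun i h1 h2 =>
    (isThree_cyc hol h2.symm h1.symm).mem_alternatingGroup
  let u : Fin n → Perm (Fin n) := fun i => if h : i ≠ o ∧ i ≠ l then α ⟨cyc o l i, memA i h.1 h.2⟩ else 1
  have hu : ∀ i (h1 : i ≠ o) (h2 : i ≠ l), u i = α ⟨cyc o l i, memA i h1 h2⟩ := fun i h1 h2 => dif_pos ⟨h1, h2⟩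
  have u3 : ∀ i, i ≠ o → i ≠ l → (u i).IsThreeCycle := by
    intro i h1 h2
    rw [hu i h1 h2]
    exact aut_three hn6 α _ (isThree_cyc hol h2.symm h1.symm)
  have uinj : ∀ i j, i ≠ o → i ≠ l → j ≠ o → j ≠ l → u i = u j → i = j := by
    intro i j h1 h2 h3 h4 h
    rw [hu i h1 h2, hu j h3 h4] at h
    have := congrArg Subtype.val (α.injective (Subtype.ext h))
    have := congrArg (fun g : Perm (Fin n) => g l) this
    simpa [cyc_apply hol h2.symm h1.symm, cyc_apply hol h4.symm h3.symm, hol.symm] using this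
  have ush : ∀ i j, i ≠ o → i ≠ l → j ≠ o → j ≠ l → i ≠ j → ∃ p, u i p = u j p ∧ u i p ≠ p := by
    intro i j h1 h2 h3 h4 hij
    obtain ⟨a, b, c, g1, g2, g3, e1⟩ := exists_cyc (u3 i h1 h2)
    obtain ⟨a', b', c', g1', g2', g3', e2⟩ := exists_cyc (u3 j h3 h4)
    have A : ∀ t, (cyc o l i * cyc o l j) t = 
     cyc o l i (if t = o then l else if t = l then j else if t = j then o else t) := fun t => by
      rw [Perm.mul_apply, cyc_apply hol h4.symm h3.symm]
    simp only [cyc_apply hol h2.symm h1.symm] at A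
    have hne : cyc o l i * cyc o l j ≠ 1 := by
      intro h
      have := A o
      rw [h] at this
      simp [hol.symm, h1.symm] at this
    have hsq : (cyc o l i * cyc o l j)^2 = 1 := by
      generalize cyc o l i * cyc o l j = P at *
      have A1 := A o
      have A2 := A l
      have A3 := A i
      have A4 := A j
      simp [hol.symm, h1, h2, h3, h4, hij, hij.symm] at A1 A2 A3 A4
      refine Equiv.ext fun t => ?_
      simp only [pow_two, Perm.one_apply]
      rw [Perm.mul_apply]
      have D : t = o ∨ t = l ∨ t = i ∨ t = j ∨ P t = t := by
        have := A t
        grind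
      rcases D with h | h | h | h | h <;> simp only [h, A1, A2, A3, A4]
    rw [e1, e2]
    apply share g1 g2 g3 g1' g2' g3'
    · rw [← e1, ← e2, hu i h1 h2, hu j h3 h4, ← Subgroup.coe_mul, ← map_mul]
      intro h
      have h := (map_eq_one_iff α α.injective).1 (Subtype.ext h)
      exact hne (congrArg Subtype.val h)
    · rw [← e1, ← e2, hu i h1 h2, hu j h3 h4, ← Subgroup.coe_mul, ← map_mul, ← Subgroup.coe_pow, ← map_pow]
      have : ((⟨cyc o l i, memA i h1 h2⟩ : alternatingGroup (Fin n)) * ⟨cyc o l j, memA j h3 h4⟩)^2 = 1 := 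
        Subtype.ext hsq
      rw [this, map_one]; rfl
  have three_rep : ∀ x : Perm (Fin n), x.IsThreeCycle → ∀ p, x p ≠ p → p ≠ x p ∧ x p ≠ x (x p) ∧ p ≠ x (x p) ∧ x = cyc p (x p) (x (x p)) := by
    intro x hx p hp
    have hp' : p ∈ x.support := mem_support.2 hp
    have h1 := hx.nodup_iff_mem_support.2 hp'
    have h2 := hx.eq_swap_mul_swap_iff_mem_support.2 hp'
    exact ⟨by grind, by grind, by grind, h2⟩
  obtain ⟨a, q1, q2⟩ := ush m k hmo hml hko hkl hmk
  obtain ⟨b, hb⟩ : ∃ b, b = u m a := ⟨_, rfl⟩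
  have hab : a ≠ b := by rw [hb]; exact q2.symm
  have um := three_rep _ (u3 m hmo hml) a q2
  have uk := three_rep _ (u3 k hko hkl) a (by rw [← q1]; exact q2)
  rw [← q1, ← hb] at uk
  rw [← hb] at um
  have hcd : u m b ≠ u k b := by
    intro h
    apply hmk
    apply uinj m k hmo hml hko hkl
    rw [um.2.2.2, uk.2.2.2, h]
  have hall : ∀ i, i ≠ o → i ≠ l → u i a = b := by
    intro i h1 h2
    by_cases him : i = m
    · rw [him, ← hb]
    by_cases hik : i = k
    · rw [hik, ← q1, ← hb]
    obtain ⟨p, p1, p2⟩ := ush m i hmo hml h1 h2 (Ne.symm him)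
    obtain ⟨q, s1, s2⟩ := ush k i hko hkl h1 h2 (Ne.symm hik)
    obtain ⟨e, f, g, g1, g2, g3, e1⟩ := exists_cyc (u3 i h1 h2)
    rw [e1] at p1 s1 ⊢
    rw [um.2.2.2] at p1 p2
    rw [uk.2.2.2] at s1 s2
    exact share3 um.1 um.2.1 um.2.2.1 uk.2.1.symm uk.2.2.1.symm hcd g1 g2 g3 p1 p2 s1 s2
  have urep : ∀ i, i ≠ o → i ≠ l → b ≠ u i b ∧ a ≠ u i b ∧ u i = cyc a b (u i b) := by
    intro i h1 h2
    have := three_rep _ (u3 i h1 h2) a (by rw [hall i h1 h2]; exact hab.symm)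
    rw [hall i h1 h2] at this
    exact this.2
  let f : Fin n → Fin n := fun i => if i = o then a else if i = l then b else u i b
  have finj : Function.Injective f := by
    intro i j hij
    have fo : f o = a := by simp [f]
    have fl : f l = b := by simp [f, hol.symm]
    have fi : ∀ i, i ≠ o → i ≠ l → f i = u i b := by intro i h1 h2; simp [f, h1, h2]
    by_cases io : i = o
    · rw [io, fo] at hij
      by_cases jo : j = o
      · rw [io, jo]
      by_cases jl : j = l
      · rw [jl, fl] at hij; exact absurd hij hab
      · rw [fi j jo jl] at hij; exact absurd hij (urep j jo jl).2.1
    by_cases il : i = l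
    · rw [il, fl] at hij
      by_cases jo : j = o
      · rw [jo, fo] at hij; exact absurd hij.symm hab
      by_cases jl : j = l
      · rw [il, jl]
      · rw [fi j jo jl] at hij; exact absurd hij (urep j jo jl).1
    rw [fi i io il] at hij
    by_cases jo : j = o
    · rw [jo, fo] at hij; exact absurd hij.symm (urep i io il).2.1
    by_cases jl : j = l
    · rw [jl, fl] at hij; exact absurd hij.symm (urep i io il).1
    rw [fi j jo jl] at hij
    apply uinj i j io il jo jl
    rw [(urep i io il).2.2, (urep j jo jl).2.2, hij]
  let s : Perm (Fin n) := Equiv.ofBijective f (Finite.injective_iff_bijective.1 finj)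
  have so : s o = a := by simp [s, f]
  have sl : s l = b := by simp [s, f, hol.symm]
  have si : ∀ i, i ≠ o → i ≠ l → s i = u i b := by intro i h1 h2; simp [s, f, h1, h2]
  refine ⟨s, ?_⟩
  let F1 : alternatingGroup (Fin n) →* Perm (Fin n) := (alternatingGroup (Fin n)).subtype.comp α.toMonoidHom
  let F2 : alternatingGroup (Fin n) →* Perm (Fin n) := (MulAut.conj s).toMonoidHom.comp (alternatingGroup (Fin n)).subtype
  have := gen ((F1.eqLocus F2).map (alternatingGroup (Fin n)).subtype) o l hol (by
    intro i h1 h2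
    refine ⟨⟨cyc o l i, memA i h1 h2⟩, ?_, rfl⟩
    show (α ⟨cyc o l i, memA i h1 h2⟩ : Perm (Fin n)) = s * cyc o l i * s⁻¹
    rw [← hu i h1 h2, cyc_conj, so, sl, si i h1 h2]
    exact (urep i h1 h2).2.2)
  intro g
  obtain ⟨g', hg', e⟩ := this g.2
  have : g' = g := Subtype.ext e
  subst this
  exact hg'

theorem conj_inj {n : ℕ} (hn : 5 ≤ n) :
    Function.Injective (MulAut.conjNormal : Perm (Fin n) →* MulAut (alternatingGroup (Fin n))) := by
  rw [injective_iff_map_eq_one]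
  intro s hs
  by_contra hne
  obtain ⟨a, ha⟩ : ∃ a, s a ≠ a := by
    by_contra! h; apply hne; ext t; simp [h]
  obtain ⟨c, hc⟩ : ∃ c, c ∉ ({a, s a} : Finset (Fin n)) := by
    by_contra! h
    have := Finset.card_le_two (a := a) (b := s a)
    rw [Finset.eq_univ_of_forall h] at this
    simp at this; omega
  obtain ⟨d, hd⟩ : ∃ d, d ∉ ({a, s a, c} : Finset (Fin n)) := by
    by_contra! h
    have := Finset.card_le_three (a := a) (b := s a) (c := c)
    rw [Finset.eq_univ_of_forall h] at this
    simp at this; omega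
  simp only [Finset.mem_insert, Finset.mem_singleton, not_or] at hc hd
  have h1 : a ≠ c := Ne.symm hc.1
  have h2 : c ≠ d := Ne.symm hd.2.2
  have h3 : a ≠ d := Ne.symm hd.1
  have := congrArg (fun f : MulAut (alternatingGroup (Fin n)) => 
    ((f ⟨cyc a c d, (isThree_cyc h1 h2 h3).mem_alternatingGroup⟩ : alternatingGroup (Fin n)) : Perm (Fin n))) hs
  simp only [MulAut.conjNormal_apply, MulAut.one_apply, cyc_conj] at this
  have := congrArg (fun g : Perm (Fin n) => g (s a)) this
  have i1 : s a ≠ s c := fun h => h1 (s.injective h)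
  have i2 : s c ≠ s d := fun h => h2 (s.injective h)
  have i3 : s a ≠ s d := fun h => h3 (s.injective h)
  simp only [cyc_apply h1 h2 h3, cyc_apply i1 i2 i3] at this
  grind

theorem conj_bij {n : ℕ} (hn : 5 ≤ n) (hn6 : n ≠ 6) :
    Function.Bijective (MulAut.conjNormal : Perm (Fin n) →* MulAut (alternatingGroup (Fin n))) := by
  refine ⟨conj_inj hn, fun α => ?_⟩
  obtain ⟨s, hs⟩ := aut_inner hn hn6 α
  refine ⟨s, ?_⟩
  ext1 g
  apply Subtype.ext
  rw [MulAut.conjNormal_apply, hs]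

theorem stmt_7 (n : ℕ) (hn : 5 ≤ n) (hn6 : n ≠ 6) (N : Type*) [Group N]
    (hcard : Nat.card N = n.factorial)
    (hA : ∃ H : Subgroup N, Nonempty (H ≃* alternatingGroup (Fin n))) :
    Nonempty (N ≃* Equiv.Perm (Fin n)) ∨
      Nonempty (N ≃* (alternatingGroup (Fin n) × Multiplicative (ZMod 2))) := by
  obtain ⟨H, ⟨e⟩⟩ := hA
  have : Nontrivial (Fin n) := Fin.nontrivial_iff_two_le.2 (by omega)
  have hfin : Finite N := Nat.finite_of_card_ne_zero (by rw [hcard]; exact n.factorial_ne_zero)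
  have hPc : Nat.card (Perm (Fin n)) = n.factorial := by rw [Nat.card_perm, Nat.card_fin]
  have hAc : 2 * Nat.card (alternatingGroup (Fin n)) = n.factorial := by
    rw [two_mul_nat_card_alternatingGroup, hPc]
  have hHc : Nat.card H = Nat.card (alternatingGroup (Fin n)) := Nat.card_congr e.toEquiv
  have hidx : H.index = 2 := by
    have h := H.index_mul_card
    rw [hcard, ← hAc, hHc] at h
    exact Nat.eq_of_mul_eq_mul_right Nat.card_pos h
  have hnorm : H.Normal := Subgroup.normal_of_index_eq_two hidx
  let E := MulEquiv.ofBijective _ (conj_bij hn hn6)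
  let φ : N →* Perm (Fin n) := E.symm.toMonoidHom.comp ((MulAut.congr e).toMonoidHom.comp MulAut.conjNormal)
  have hφ : ∀ g, MulAut.conjNormal (φ g) = MulAut.congr e (MulAut.conjNormal g) := fun g => 
    E.apply_symm_apply _
  have hφH : ∀ h : H, φ h = e h := by
    intro h
    apply conj_inj hn
    rw [hφ]
    ext1 x
    apply Subtype.ext
    rw [MulAut.conjNormal_apply]
    have : MulAut.conjNormal (h : N) (e.symm x) = h * e.symm x * h⁻¹ := by
      apply Subtype.ext; rw [MulAut.conjNormal_apply]; rfl
    show ((e (MulAut.conjNormal (h : N) (e.symm x)) : alternatingGroup (Fin n)) : Perm (Fin n)) = _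
    rw [this]
    simp
  by_cases hinj : Function.Injective φ
  · left
    exact ⟨MulEquiv.ofBijective φ ((Nat.bijective_iff_injective_and_card φ).2 ⟨hinj, by rw [hcard, hPc]⟩)⟩
  right
  rw [injective_iff_map_eq_one] at hinj
  push Not at hinj
  obtain ⟨k, hk, hk1⟩ := hinj
  have hHk : ∀ h : N, h ∈ H → φ h = 1 → h = 1 := by
    intro h hh h1
    rw [hφH ⟨h, hh⟩] at h1
    have h1 : e ⟨h, hh⟩ = 1 := Subtype.ext h1
    have := (map_eq_one_iff e e.injective).1 h1
    exact congrArg Subtype.val this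
  have kk : k * k = 1 := hHk _ (Subgroup.mul_self_mem_of_index_two hidx k) (by rw [map_mul, hk, one_mul])
  have kcomm : ∀ h : H, Commute (h : N) k := by
    intro h
    have h1 := hφ k
    rw [hk, map_one] at h1
    have h2 : (MulAut.conjNormal k : MulAut H) = 1 := by
      apply (MulAut.congr e).injective; rw [← h1, map_one]
    have h3 := congrArg (fun f : MulAut H => ((f h : H) : N)) h2
    simp only [MulAut.conjNormal_apply, MulAut.one_apply] at h3
    have := mul_inv_eq_iff_eq_mul.1 h3
    exact this.symm
  let f : Multiplicative (ZMod 2) →* N := MonoidHom.mk' (fun z => if z = 1 then 1 else k) (by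
    have : ∀ z : Multiplicative (ZMod 2), z = 1 ∨ z = Multiplicative.ofAdd 1 := by decide
    have n1 : (Multiplicative.ofAdd (1 : ZMod 2)) ≠ 1 := by decide
    have n2 : (Multiplicative.ofAdd (1 : ZMod 2)) * Multiplicative.ofAdd (1 : ZMod 2) = 1 := by decide
    intro x y
    rcases this x with rfl | rfl <;> rcases this y with rfl | rfl <;> simp [n1, n2, kk])
  have hf : ∀ z, f z = if z = 1 then 1 else k := fun z => rfl
  let g : alternatingGroup (Fin n) →* N := H.subtype.comp e.symm.toMonoidHom
  have hg : ∀ x, g x = (e.symm x : H) := fun x => rfl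
  have hcomm : ∀ x z, Commute (g x) (f z) := by
    intro x z
    rw [hf, hg]
    split_ifs
    · exact Commute.one_right _
    · exact kcomm _
  let Φ := MonoidHom.noncommCoprod g f hcomm
  have Φinj : Function.Injective Φ := by
    rw [injective_iff_map_eq_one]
    rintro ⟨x, z⟩ h
    rw [MonoidHom.noncommCoprod_apply] at h
    simp only at h
    have hφf : φ (f z) = 1 := by rw [hf]; split_ifs <;> simp [hk]
    have hx : g x = 1 := by
      apply hHk
      · exact (e.symm x).2
      · have := congrArg φ h
        rwa [map_mul, hφf, mul_one, map_one] at this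
    rw [hx, one_mul, hf] at h
    have hz : z = 1 := by
      by_contra hz
      rw [if_neg hz] at h
      exact hk1 h
    have hx1 : e.symm x = 1 := Subtype.ext hx
    have hx1 : x = 1 := (map_eq_one_iff e.symm e.symm.injective).1 hx1
    rw [hx1, hz]; rfl
  refine ⟨(MulEquiv.ofBijective Φ ((Nat.bijective_iff_injective_and_card Φ).2 ⟨Φinj, ?_⟩)).symm⟩
  rw [Nat.card_prod, hcard, ← hAc, mul_comm]
  congr 1
  rw [Nat.card_eq_fintype_card]; rfl
end

section
/- Let n ≥ 5 and let N be a perfect group of order n!. Suppose f : Sₙ → Aut(N) is a group homomorphism and g : Sₙ → N is a bijective map satisfying g(στ) = g(σ) · f(σ)(g(τ)) for all σ, τ ∈ Sₙ. Then f is injective. -/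
theorem stmt_8 (n : ℕ) (hn : 5 ≤ n) (N : Type*) [Group N]
    (hcard : Nat.card N = n.factorial) (hperf : commutator N = ⊤)
    (f : Equiv.Perm (Fin n) →* MulAut N) (g : Equiv.Perm (Fin n) → N)
    (hg : Function.Bijective g)
    (hfg : ∀ σ τ : Equiv.Perm (Fin n), g (σ * τ) = g σ * f σ (g τ)) :
    Function.Injective f := by
  rw [← MonoidHom.ker_eq_bot_iff]
  by_contra hk
  haveI : Nontrivial (Fin n) := Fin.nontrivial_iff_two_le.mpr (by omega)
  have hle : alternatingGroup (Fin n) ≤ f.ker :=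
    Equiv.Perm.alternatingGroup_le_of_normal (by simpa using hn)
      ((Subgroup.nontrivial_iff_ne_bot _).mpr hk)
  let φ : alternatingGroup (Fin n) →* N := MonoidHom.mk' (fun σ => g σ.1) (by
    intro a b
    have h : f a.1 = 1 := hle a.2
    simp [hfg, h])
  have hφ : Function.Injective φ := fun a b h => Subtype.ext (hg.1 h)
  have h1 : Nat.card φ.range = Nat.card (alternatingGroup (Fin n)) :=
    (Nat.card_congr (MonoidHom.ofInjective hφ).toEquiv).symm
  have h2 := two_mul_nat_card_alternatingGroup (α := Fin n)
  have h3 := φ.range.card_mul_index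
  have h4 : Nat.card (Equiv.Perm (Fin n)) = Nat.card N :=
    Nat.card_congr (Equiv.ofBijective g hg)
  have hpos : 0 < Nat.card (alternatingGroup (Fin n)) := Nat.card_pos
  have h5 : φ.range.index = 2 := by
    rw [h1, ← h4, ← h2, mul_comm] at h3
    exact Nat.eq_of_mul_eq_mul_right hpos h3
  haveI := Subgroup.normal_of_index_eq_two h5
  have h6 : commutator N ≤ φ.range := by
    rw [commutator_def, Subgroup.commutator_le]
    intro a _ b _
    rw [commutatorElement_def]
    simp only [Subgroup.mul_mem_iff_of_index_two h5, inv_mem_iff]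
    tauto
  rw [hperf, top_le_iff] at h6
  rw [h6, Subgroup.index_top] at h5
  omega
end

section
/- Let n ≥ 5, let H be a finite perfect group, let Z be a subgroup of the center of H with exactly two elements, and let π : H → Aₙ be a surjective group homomorphism with kernel Z (so that H is a double cover 2Aₙ of Aₙ). Let r ≥ 1 with 4r ≤ n, let ζ = (1 2)(3 4)⋯(4r−1 4r) ∈ Aₙ, and let h ∈ H be any element with π(h) = ζ. Then #Cent_H(h) = #Cent_{Aₙ}(ζ). -/
namespace DCov
open Equiv Equiv.Perm
open scoped commutatorElement

structure DC {n : ℕ} {H : Type*} [Group H] (π : H →* Perm (Fin n)) (z : H) : Prop where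
  ne : z ≠ 1
  sq : z * z = 1
  comm : ∀ g, z * g = g * z
  ker : ∀ g, π g = 1 ↔ g = 1 ∨ g = z
  sgn : ∀ g, sign (π g) = 1
  lift : ∀ σ, sign σ = 1 → ∃ g, π g = σ

namespace DC
variable {n : ℕ} {H : Type*} [Group H] {π : H →* Perm (Fin n)} {z : H}

lemma swap_mul_swap_comm_aux {i j k l : Fin n} (h1 : i ≠ k) (h2 : i ≠ l) (h3 : j ≠ k) (h4 : j ≠ l) :
    swap k l * swap i j = swap i j * swap k l := by
  rw [mul_swap_eq_swap_mul, swap_apply_of_ne_of_ne h1 h2, swap_apply_of_ne_of_ne h3 h4]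

def F (π : H →* Perm (Fin n)) (m : ℕ) (g : H) : Prop := ∀ i : Fin n, m ≤ i.1 → π g i = i

def K (π : H →* Perm (Fin n)) (m : ℕ) : Subgroup H :=
  Subgroup.closure {g | g ^ 3 = 1 ∧ F π m g}

lemma F_mul {m : ℕ} {a b : H} (ha : F π m a) (hb : F π m b) : F π m (a * b) := by
  intro i hi
  rw [map_mul, Perm.mul_apply, hb i hi, ha i hi]

lemma F_inv {m : ℕ} {a : H} (ha : F π m a) : F π m a⁻¹ := by
  intro i hi
  rw [map_inv, Perm.inv_eq_iff_eq, ha i hi]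

lemma F_one {m : ℕ} : F π m 1 := by
  intro i hi; simp

lemma F_mono {m k : ℕ} (h : m ≤ k) {a : H} (ha : F π m a) : F π k a :=
  fun i hi => ha i (h.trans hi)

lemma F_of_K {m : ℕ} {g : H} (hg : g ∈ K π m) : F π m g := by
  induction hg using Subgroup.closure_induction with
  | mem x hx => exact hx.2
  | one => exact F_one
  | mul x y _ _ hx hy => exact F_mul hx hy
  | inv x _ hx => exact F_inv hx

lemma K_mono {m k : ℕ} (h : m ≤ k) : K π m ≤ K π k :=
  Subgroup.closure_mono fun _ hx => ⟨hx.1, F_mono h hx.2⟩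

lemma K_of {m : ℕ} {g : H} (h3 : g ^ 3 = 1) (hg : F π m g) : g ∈ K π m :=
  Subgroup.subset_closure ⟨h3, hg⟩

lemma K_conj {m : ℕ} {x g : H} (hx : ∀ g, F π m g → F π m (x * g * x⁻¹)) (hg : g ∈ K π m) :
    x * g * x⁻¹ ∈ K π m := by
  induction hg using Subgroup.closure_induction with
  | mem y hy => exact K_of (by rw [conj_pow, hy.1]; simp) (hx _ hy.2)
  | one => simp [one_mem]
  | mul a b _ _ ha hb =>
    have : x * (a * b) * x⁻¹ = (x * a * x⁻¹) * (x * b * x⁻¹) := by group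
    rw [this]; exact mul_mem ha hb
  | inv a _ ha =>
    have : x * a⁻¹ * x⁻¹ = (x * a * x⁻¹)⁻¹ := by group
    rw [this]; exact inv_mem ha

variable (D : DC π z)
include D

lemma pz : π z = 1 := (D.ker z).2 (Or.inr rfl)

lemma eq_or {g k : H} (h : π g = π k) : g = k ∨ g = z * k := by
  have : π (g * k⁻¹) = 1 := by simp [h]
  rcases (D.ker _).1 this with h | h
  · left; exact mul_inv_eq_one.1 h
  · right; exact mul_inv_eq_iff_eq_mul.1 h

lemma F_z {m : ℕ} {g : H} (h : F π m g) : F π m (z * g) := by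
  intro i hi
  rw [map_mul, D.pz, one_mul, h i hi]

lemma zz (g : H) : z * (z * g) = g := by rw [← mul_assoc, D.sq, one_mul]

lemma zcube (g : H) : (z * g) ^ 3 = z * g ^ 3 := by
  have : Commute z g := D.comm g
  rw [this.mul_pow]
  congr 1
  rw [pow_succ, pow_two, D.sq, one_mul]

lemma zsq (g : H) : (z * g) * (z * g) = g * g := by
  rw [mul_assoc, ← mul_assoc g z g, ← D.comm g, mul_assoc z g g, D.zz]

/-- lift of an even perm of order 3 with cube one, adjusting on the left -/
lemma lift_cube {x y : H} (h : (π x * π y) ^ 3 = 1) :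
    ∃ x', π x' = π x ∧ (x' * y) ^ 3 = 1 := by
  have h' : π ((x * y) ^ 3) = 1 := by simpa using h
  rcases (D.ker _).1 h' with h | h
  · exact ⟨x, rfl, h⟩
  · exact ⟨z * x, by simp [D.pz], by rw [mul_assoc, D.zcube, h, D.sq]⟩

def P (π : H →* Perm (Fin n)) (z : H) (m : ℕ) : Prop :=
  z ∉ K π m ∧ ∀ g, F π m g → g ∈ K π m ∨ z * g ∈ K π m

omit D in
lemma sign_ss {i j k l : Fin n} (h : i ≠ j) (h' : k ≠ l) : sign (swap i j * swap k l) = 1 := by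
  rw [Perm.sign_mul, sign_swap h, sign_swap h']; rfl

/-- transitivity -/
lemma trans {m : ℕ} (hm : 2 ≤ m) (hmn : m < n) (j : Fin n) (hj : j.1 ≤ m) :
    ∃ k, F π (m + 1) k ∧ π k j = ⟨m, hmn⟩ := by
  by_cases hjm : j.1 = m
  · exact ⟨1, F_one, by simp; exact Fin.ext hjm⟩
  obtain ⟨l, hl, hlj, hlm⟩ : ∃ l : Fin n, l.1 ≤ m ∧ l ≠ j ∧ l.1 ≠ m := by
    by_cases h0 : j.1 = 0
    · exact ⟨⟨1, by omega⟩, by simp; omega, by intro h; have := congrArg Fin.val h; simp at this; omega,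
        by simp; omega⟩
    · exact ⟨⟨0, by omega⟩, by simp, by intro h; have := congrArg Fin.val h; simp at this; omega,
        by simp; omega⟩
  have hjm' : j ≠ ⟨m, hmn⟩ := fun h => hjm (congrArg Fin.val h)
  have hlm' : l ≠ ⟨m, hmn⟩ := fun h => hlm (congrArg Fin.val h)
  obtain ⟨k, hk⟩ := D.lift (swap l ⟨m, hmn⟩ * swap j l) (sign_ss hlm' hlj.symm)
  refine ⟨k, ?_, ?_⟩
  · intro i hi
    rw [hk, Perm.mul_apply, swap_apply_of_ne_of_ne (a := j), swap_apply_of_ne_of_ne]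
    all_goals (rintro rfl; simp at * <;> omega)
  · rw [hk, Perm.mul_apply, swap_apply_left, swap_apply_left]

lemma step {m : ℕ} (hm : 2 ≤ m) (hmn : m + 1 < n) (hP : P π z (m + 1)) {x y : H}
    (hx : F π (m + 2) x) (hx2 : x * x = 1) (hxm : π x ⟨m, by omega⟩ = ⟨m + 1, hmn⟩)
    (hy : y ∈ K π (m + 1)) (hxy : (x * y) ^ 3 = 1)
    (hc : ∀ k ∈ K π (m + 1), x * k * x ∈ K π (m + 1) ∨
      ∃ a ∈ K π (m + 1), ∃ b ∈ K π (m + 1), x * k * x = a * x * b) :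
    P π z (m + 2) ∧ x ∈ K π (m + 2) ∧ ∀ k ∈ K π (m + 2), k ∈ K π (m + 1) ∨
      ∃ a ∈ K π (m + 1), ∃ b ∈ K π (m + 1), k = a * x * b := by
  have hxi : x⁻¹ = x := inv_eq_of_mul_eq_one_left hx2
  let S : Subgroup H :=
    { carrier := {k | k ∈ K π (m + 1) ∨ ∃ a ∈ K π (m + 1), ∃ b ∈ K π (m + 1), k = a * x * b}
      one_mem' := Or.inl (one_mem _)
      mul_mem' := by
        rintro s t (hs | ⟨a, ha, b, hb, rfl⟩) (ht | ⟨c, hc', d, hd, rfl⟩)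
        · exact Or.inl (mul_mem hs ht)
        · exact Or.inr ⟨s * c, mul_mem hs hc', d, hd, by group⟩
        · exact Or.inr ⟨a, ha, b * t, mul_mem hb ht, by group⟩
        · have e : a * x * b * (c * x * d) = a * (x * (b * c) * x) * d := by group
          rcases hc (b * c) (mul_mem hb hc') with h | ⟨p, hp, q, hq, h⟩
          · left; rw [e]; exact mul_mem (mul_mem ha h) hd
          · right; rw [e, h]
            exact ⟨a * p, mul_mem ha hp, q * d, mul_mem hq hd, by group⟩
      inv_mem' := by
        rintro s (hs | ⟨a, ha, b, hb, rfl⟩)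
        · exact Or.inl (inv_mem hs)
        · exact Or.inr ⟨b⁻¹, inv_mem hb, a⁻¹, inv_mem ha, by
            rw [mul_inv_rev, mul_inv_rev, hxi, mul_assoc]⟩ }
  have hKS : K π (m + 1) ≤ S := fun k hk => Or.inl hk
  have hxS : x ∈ S := Or.inr ⟨1, one_mem _, 1, one_mem _, by simp⟩
  have hzS : z ∉ S := by
    rintro (h | ⟨a, ha, b, hb, h⟩)
    · exact hP.1 h
    · have e : π x = π (a⁻¹ * b⁻¹) := by
        have : π (a * x * b) = 1 := by rw [← h, D.pz]
        simp only [map_mul, map_inv] at this ⊢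
        rw [mul_eq_one_iff_eq_inv] at this
        rw [← this]; group
      have e2 := F_of_K (mul_mem (inv_mem ha) (inv_mem hb)) ⟨m + 1, hmn⟩ (le_refl _)
      rw [← e] at e2
      have := (π x).injective (e2.trans hxm.symm)
      simp at this
  have hG1 : ∀ g, F π (m + 1) g → g ∈ S ∨ z * g ∈ S := fun g hg =>
    (hP.2 g hg).imp (fun h => hKS h) (fun h => hKS h)
  have hzmul : ∀ a b, (a ∈ S ∨ z * a ∈ S) → (b ∈ S ∨ z * b ∈ S) → (a * b ∈ S ∨ z * (a * b) ∈ S) := by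
    rintro a b (ha | ha) (hb | hb)
    · exact Or.inl (mul_mem ha hb)
    · right
      have := mul_mem ha hb
      rwa [← mul_assoc, ← D.comm, mul_assoc] at this
    · right
      have := mul_mem ha hb
      rwa [mul_assoc] at this
    · left
      have := mul_mem ha hb
      rwa [D.comm a, mul_assoc, D.zz] at this
  have hG : ∀ g, F π (m + 2) g → g ∈ S ∨ z * g ∈ S := by
    intro g hg
    by_cases hgm : π g ⟨m + 1, hmn⟩ = ⟨m + 1, hmn⟩
    · apply hG1
      intro i hi
      by_cases h : i.1 = m + 1
      · have : i = ⟨m + 1, hmn⟩ := Fin.ext h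
        rw [this, hgm]
      · exact hg i (by omega)
    · have hj : (π g ⟨m + 1, hmn⟩).1 ≤ m := by
        by_contra hcon
        have h1 : m + 2 ≤ (π g ⟨m + 1, hmn⟩).1 := by
          have : (π g ⟨m + 1, hmn⟩).1 ≠ m + 1 := fun h => hgm (Fin.ext h)
          omega
        exact hgm ((π g).injective (hg _ h1))
      obtain ⟨k, hk, hkj⟩ := D.trans hm (by omega) _ hj
      have h3 : F π (m + 1) (x * k * g) := by
        intro i hi
        by_cases h : i.1 = m + 1
        · have : i = ⟨m + 1, hmn⟩ := Fin.ext h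
          rw [this]; simp only [map_mul, Perm.mul_apply]
          rw [hkj, hxm]
        · exact F_mul (F_mul hx (F_mono (by omega) hk)) hg i (by omega)
      have e : g = k⁻¹ * (x * (x * k * g)) := by
        rw [mul_assoc x k g, ← mul_assoc x x, hx2]; group
      rw [e]
      exact hzmul _ _ (hG1 _ (F_inv hk)) (hzmul _ _ (Or.inl hxS) (hG1 _ h3))
  have hKle : K π (m + 2) ≤ S := by
    refine (Subgroup.closure_le _).2 ?_
    rintro g ⟨hg3, hg⟩
    rcases hG g hg with h | h
    · exact h
    · exfalso
      have := pow_mem h 3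
      rw [D.zcube, hg3, mul_one] at this
      exact hzS this
  have hyF := F_mono (show m + 1 ≤ m + 2 by omega) (F_of_K hy)
  have hxK : x ∈ K π (m + 2) := by
    have h1 := K_of hxy (F_mul hx hyF)
    have h2 : y ∈ K π (m + 2) := K_mono (by omega) hy
    have := mul_mem h1 (inv_mem h2)
    rwa [mul_inv_cancel_right] at this
  have hSle : S ≤ K π (m + 2) := by
    have hm1 : K π (m + 1) ≤ K π (m + 2) := K_mono (by omega)
    rintro s (hs | ⟨a, ha, b, hb, rfl⟩)
    · exact hm1 hs
    · exact mul_mem (mul_mem (hm1 ha) hxK) (hm1 hb)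
  refine ⟨⟨fun h => hzS (hKle h), fun g hg => (hG g hg).imp (fun h => hSle h) (fun h => hSle h)⟩,
    hxK, fun k hk => hKle hk⟩


lemma F2 (hn : 5 ≤ n) {g : H} (hg : F π 2 g) : g = 1 ∨ g = z := by
  rw [← D.ker]
  have h0 : 0 < n := by omega
  have h1 : 1 < n := by omega
  have hlt : ∀ i : Fin n, i.1 < 2 → (π g i).1 < 2 := by
    intro i hi
    by_contra hcon
    have := congrArg Fin.val ((π g).injective (hg (π g i) (by omega)))
    omega
  by_cases h : π g ⟨0, h0⟩ = ⟨0, h0⟩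
  · have h' : π g ⟨1, h1⟩ = ⟨1, h1⟩ := by
      have a := hlt ⟨1, h1⟩ (by simp)
      have b : π g ⟨1, h1⟩ ≠ ⟨0, h0⟩ := fun e => by
        have := (π g).injective (e.trans h.symm); simp at this
      have c : (π g ⟨1, h1⟩).1 ≠ 0 := fun e => b (Fin.ext e)
      apply Fin.ext; simp; omega
    ext i
    simp only [Perm.one_apply]
    by_cases hi : 2 ≤ i.1
    · rw [hg i hi]
    · have : i = ⟨0, h0⟩ ∨ i = ⟨1, h1⟩ := by
        simp only [Fin.ext_iff]; omega
      rcases this with rfl | rfl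
      · rw [h]
      · rw [h']
  · exfalso
    have e0 : π g ⟨0, h0⟩ = ⟨1, h1⟩ := by
      have a := hlt ⟨0, h0⟩ (by simp)
      have c : (π g ⟨0, h0⟩).1 ≠ 0 := fun e => h (Fin.ext e)
      apply Fin.ext; simp; omega
    have e1 : π g ⟨1, h1⟩ = ⟨0, h0⟩ := by
      have a := hlt ⟨1, h1⟩ (by simp)
      have b : π g ⟨1, h1⟩ ≠ ⟨1, h1⟩ := fun e => by
        have := (π g).injective (e.trans e0.symm); simp at this
      have c : (π g ⟨1, h1⟩).1 ≠ 1 := fun e => b (Fin.ext e)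
      apply Fin.ext; simp; omega
    have : π g = swap ⟨0, h0⟩ ⟨1, h1⟩ := by
      ext i
      by_cases hi : 2 ≤ i.1
      · rw [hg i hi, swap_apply_of_ne_of_ne]
        all_goals (rintro rfl; simp at hi)
      · have : i = ⟨0, h0⟩ ∨ i = ⟨1, h1⟩ := by
          simp only [Fin.ext_iff]; omega
        rcases this with rfl | rfl
        · rw [e0, swap_apply_left]
        · rw [e1, swap_apply_right]
    have hs := D.sgn g
    rw [this, sign_swap (by simp)] at hs
    exact absurd hs (by decide)

omit D in
lemma cube_ss {i j k : Fin n} (h1 : i ≠ j) (h2 : j ≠ k) (h3 : i ≠ k) :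
    (swap i j * swap j k) ^ 3 = 1 := by
  have := (isThreeCycle_swap_mul_swap_same (a := j) h1.symm h2 h3).orderOf
  rw [swap_comm j i] at this
  rw [← this, pow_orderOf_eq_one]

omit D in
lemma cube_ss' {i j k : Fin n} (h1 : i ≠ j) (h2 : j ≠ k) (h3 : i ≠ k) :
    (swap j k * swap i j) ^ 3 = 1 := by
  rw [swap_comm j k, swap_comm i j]
  exact cube_ss h2.symm h1.symm h3.symm

omit D in
lemma ss_fix {i j k l x : Fin n} (h1 : x ≠ i) (h2 : x ≠ j) (h3 : x ≠ k) (h4 : x ≠ l) :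
    (swap i j * swap k l) x = x := by
  rw [Perm.mul_apply, swap_apply_of_ne_of_ne h3 h4, swap_apply_of_ne_of_ne h1 h2]

lemma base (hn : 5 ≤ n) : P π z 3 ∧ ∃ t ∈ K π 3, t ^ 3 = 1 ∧
    π t = swap ⟨0, by omega⟩ ⟨1, by omega⟩ * swap ⟨1, by omega⟩ ⟨2, by omega⟩ ∧
    ∀ k ∈ K π 3, k = 1 ∨ k = t ∨ k = t * t := by
  have h0 : 0 < n := by omega
  have h1 : 1 < n := by omega
  have h2 : 2 < n := by omega
  have n01 : (⟨0, h0⟩ : Fin n) ≠ ⟨1, h1⟩ := by simp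
  have n12 : (⟨1, h1⟩ : Fin n) ≠ ⟨2, h2⟩ := by simp
  have n02 : (⟨0, h0⟩ : Fin n) ≠ ⟨2, h2⟩ := by simp
  obtain ⟨t0, ht0⟩ := D.lift (swap ⟨0, h0⟩ ⟨1, h1⟩ * swap ⟨1, h1⟩ ⟨2, h2⟩) (sign_ss n01 n12)
  obtain ⟨t, ht, ht3⟩ := D.lift_cube (x := t0) (y := 1) (by
    rw [map_one, mul_one, ht0]; exact cube_ss n01 n12 n02)
  rw [mul_one] at ht3
  rw [ht0] at ht
  have a0 : π t ⟨0, h0⟩ = ⟨1, h1⟩ := by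
    rw [ht, Perm.mul_apply, swap_apply_of_ne_of_ne n01 n02, swap_apply_left]
  have a1 : π t ⟨1, h1⟩ = ⟨2, h2⟩ := by
    rw [ht, Perm.mul_apply, swap_apply_left, swap_apply_of_ne_of_ne n02.symm n12.symm]
  have a2 : π t ⟨2, h2⟩ = ⟨0, h0⟩ := by
    rw [ht, Perm.mul_apply, swap_apply_right, swap_apply_right]
  have tF : F π 3 t := by
    intro i hi
    rw [ht]; apply ss_fix
    all_goals (rintro rfl; simp at hi)
  have tK : t ∈ K π 3 := K_of ht3 tF
  have hT : ∀ k ∈ Subgroup.zpowers t, k = 1 ∨ k = t ∨ k = t * t := by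
    rintro _ ⟨i, rfl⟩
    have e : (t ^ i : H) = t ^ (i % 3) := by
      conv_lhs => rw [← Int.mul_ediv_add_emod i 3, zpow_add, zpow_mul]
      rw [show (t ^ (3 : ℤ)) = 1 from by exact_mod_cast ht3]; simp
    have : i % 3 = 0 ∨ i % 3 = 1 ∨ i % 3 = 2 := by omega
    simp only [e]
    rcases this with h | h | h <;> rw [h]
    · simp
    · simp
    · right; right; exact_mod_cast pow_two t
  have tT : t ∈ Subgroup.zpowers t := Subgroup.mem_zpowers t
  have zT : z ∉ Subgroup.zpowers t := by
    intro h
    rcases hT z h with h | h | h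
    · exact D.ne h
    · have := D.pz; rw [h] at this; rw [this] at a2; simp at a2
    · have := D.pz; rw [h] at this
      have e : π (t * t) ⟨2, h2⟩ = ⟨1, h1⟩ := by rw [map_mul, Perm.mul_apply, a2, a0]
      rw [this] at e; simp at e
  have hG : ∀ g, F π 3 g → g ∈ Subgroup.zpowers t ∨ z * g ∈ Subgroup.zpowers t := by
    intro g hg
    have key : ∃ k ∈ Subgroup.zpowers t, F π 3 k ∧ π k (π g ⟨2, h2⟩) = ⟨2, h2⟩ := by
      have hlt : (π g ⟨2, h2⟩).1 < 3 := by
        by_contra hcon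
        have := congrArg Fin.val ((π g).injective (hg (π g ⟨2, h2⟩) (by omega)))
        rw [this] at hcon
        simp at hcon
      have : π g ⟨2, h2⟩ = ⟨0, h0⟩ ∨ π g ⟨2, h2⟩ = ⟨1, h1⟩ ∨ π g ⟨2, h2⟩ = ⟨2, h2⟩ := by
        simp only [Fin.ext_iff]; omega
      rcases this with h | h | h
      · exact ⟨t * t, mul_mem tT tT, F_mul tF tF, by rw [h, map_mul, Perm.mul_apply, a0, a1]⟩
      · exact ⟨t, tT, tF, by rw [h, a1]⟩
      · exact ⟨1, one_mem _, F_one, by rw [h]; simp⟩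
    obtain ⟨k, hkT, hkF, hk⟩ := key
    have hF2 : F π 2 (k * g) := by
      intro i hi
      by_cases h : i.1 = 2
      · have : i = ⟨2, h2⟩ := Fin.ext h
        rw [this, map_mul, Perm.mul_apply, hk]
      · exact F_mul hkF hg i (by omega)
    rcases D.F2 hn hF2 with h | h
    · left; rw [eq_inv_of_mul_eq_one_right h]; exact inv_mem hkT
    · right
      have : z * g = k⁻¹ := by
        apply eq_inv_of_mul_eq_one_right
        rw [← mul_assoc, ← D.comm, mul_assoc, h, D.sq]
      rw [this]; exact inv_mem hkT
  have hle : K π 3 ≤ Subgroup.zpowers t := by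
    refine (Subgroup.closure_le _).2 ?_
    rintro g ⟨hg3, hg⟩
    rcases hG g hg with h | h
    · exact h
    · exfalso
      have := pow_mem h 3
      rw [D.zcube, hg3, mul_one] at this
      exact zT this
  have hge : Subgroup.zpowers t ≤ K π 3 := by
    rw [Subgroup.zpowers_le]; exact tK
  exact ⟨⟨fun h => zT (hle h), fun g hg => (hG g hg).imp (fun h => hge h) (fun h => hge h)⟩,
    t, tK, ht3, ht, fun k hk => hT k (hle hk)⟩

omit D in
lemma braid {x y : H} (hx : x * x = 1) (hxy : (x * y) ^ 3 = 1) : x * y * x = y⁻¹ * x * y⁻¹ := by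
  have hxi : x⁻¹ = x := inv_eq_of_mul_eq_one_left hx
  have : x * y * x * (y * x * y) = 1 := by
    rw [← hxy]; simp only [pow_succ, pow_zero, one_mul, mul_assoc]
  rw [eq_inv_of_mul_eq_one_left this]
  simp only [mul_inv_rev, hxi, mul_assoc]

def Q (π : H →* Perm (Fin n)) (z : H) (m : ℕ) (hn : 5 ≤ n) (hm : m + 1 < n) : Prop :=
  P π z (m + 2) ∧ ∃ y ∈ K π (m + 2),
    π y = swap ⟨0, by omega⟩ ⟨1, by omega⟩ * swap ⟨m, by omega⟩ ⟨m + 1, hm⟩ ∧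
    ∀ k ∈ K π (m + 2), k ∈ K π (m + 1) ∨
      ∃ a ∈ K π (m + 1), ∃ b ∈ K π (m + 1), k = a * y * b

def Inv (π : H →* Perm (Fin n)) : Prop := ∀ (i j k l : Fin n) (g : H), i ≠ j → i ≠ k → i ≠ l →
  j ≠ k → j ≠ l → k ≠ l → π g = swap i j * swap k l → g * g = 1

lemma Q2 (hn : 5 ≤ n) (hI : Inv π) : Q π z 2 hn (by omega) := by
  obtain ⟨hP, t, tK, t3, ht, hK⟩ := D.base hn
  have h0 : 0 < n := by omega
  have h1 : 1 < n := by omega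
  have h2 : 2 < n := by omega
  have h3 : 3 < n := by omega
  obtain ⟨x0, hx0⟩ := D.lift (swap ⟨0, h0⟩ ⟨1, h1⟩ * swap ⟨2, h2⟩ ⟨3, h3⟩)
    (sign_ss (by simp) (by simp))
  obtain ⟨x, hx, hxt⟩ := D.lift_cube (x := x0) (y := t) (by
    rw [hx0, ht, ← swap_mul_swap_comm_aux (i := (⟨0, h0⟩ : Fin n)) (j := ⟨1, h1⟩)
      (k := ⟨2, h2⟩) (l := ⟨3, h3⟩) (by simp) (by simp) (by simp) (by simp)]
    rw [mul_assoc, ← mul_assoc (swap _ _) (swap _ _) (swap _ _), swap_mul_self, one_mul]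
    exact cube_ss' (by simp) (by simp) (by simp))
  rw [hx0] at hx
  have hx2 : x * x = 1 := hI _ _ _ _ x (by simp) (by simp) (by simp) (by simp) (by simp) (by simp) hx
  have hb := braid hx2 hxt
  have := D.step (m := 2) (x := x) (y := t) (by omega) (by omega) hP ?_ hx2 ?_ tK hxt ?_
  · exact ⟨this.1, x, this.2.1, hx, this.2.2⟩
  · intro i hi
    rw [hx]; apply ss_fix
    all_goals (rintro rfl; simp at hi)
  · rw [hx, Perm.mul_apply, swap_apply_left, swap_apply_of_ne_of_ne] <;> simp
  · intro k hk
    rcases hK k hk with rfl | rfl | rfl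
    · left; rw [mul_one, hx2]; exact one_mem _
    · right; exact ⟨_, inv_mem hk, _, inv_mem hk, hb⟩
    · right
      have e : t * t = t⁻¹ := eq_inv_of_mul_eq_one_left (by rw [← t3]; simp [pow_succ])
      refine ⟨t, tK, t, tK, ?_⟩
      have := congrArg (·⁻¹) hb
      have hxi : x⁻¹ = x := inv_eq_of_mul_eq_one_left hx2
      simp only [mul_inv_rev, hxi, inv_inv] at this
      rw [e, mul_assoc, this, mul_assoc]

lemma Qstep (hn : 5 ≤ n) (hI : Inv π) {m : ℕ} (hm2 : 2 ≤ m) (hm : m + 2 < n)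
    (hQ : Q π z m hn (by omega)) : Q π z (m + 1) hn hm := by
  obtain ⟨hP, y, yK, hy, hK⟩ := hQ
  have h0 : 0 < n := by omega
  have h1 : 1 < n := by omega
  have hm0 : m < n := by omega
  have hm1 : m + 1 < n := by omega
  have ne1 : ∀ a b (ha : a < n) (hb : b < n), a ≠ b → (⟨a, ha⟩ : Fin n) ≠ ⟨b, hb⟩ := by
    intro a b ha hb h e; exact h (congrArg Fin.val e)
  obtain ⟨x0, hx0⟩ := D.lift (swap ⟨0, h0⟩ ⟨1, h1⟩ * swap ⟨m + 1, hm1⟩ ⟨m + 2, hm⟩)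
    (sign_ss (by simp) (by simp))
  obtain ⟨x, hx, hxy⟩ := D.lift_cube (x := x0) (y := y) (by
    rw [hx0, hy, ← swap_mul_swap_comm_aux (i := (⟨0, h0⟩ : Fin n)) (j := ⟨1, h1⟩)
      (k := ⟨m + 1, hm1⟩) (l := ⟨m + 2, hm⟩) (ne1 _ _ _ _ (by omega)) (ne1 _ _ _ _ (by omega))
      (ne1 _ _ _ _ (by omega)) (ne1 _ _ _ _ (by omega))]
    rw [mul_assoc, ← mul_assoc (swap _ _) (swap _ _) (swap _ _), swap_mul_self, one_mul]
    exact cube_ss' (by simp) (by simp) (by simp))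
  rw [hx0] at hx
  have hx2 : x * x = 1 := hI _ _ _ _ x (by simp) (ne1 _ _ _ _ (by omega)) (ne1 _ _ _ _ (by omega))
    (ne1 _ _ _ _ (by omega)) (ne1 _ _ _ _ (by omega)) (by simp) hx
  have hb := braid hx2 hxy
  have hxi : x⁻¹ = x := inv_eq_of_mul_eq_one_left hx2
  have hconj : ∀ k ∈ K π (m + 1), x * k * x ∈ K π (m + 1) := by
    intro k hk
    have := K_conj (x := x) (g := k) (m := m + 1) ?_ hk
    · rwa [hxi] at this
    intro g hg i hi
    have hi' : m + 1 ≤ (π x⁻¹ i).1 := by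
      rw [hxi, hx, Perm.mul_apply]
      have hF : m + 1 ≤ (swap (⟨m + 1, hm1⟩ : Fin n) ⟨m + 2, hm⟩ i).1 := by
        rw [swap_apply_def]; split_ifs <;> simp [hi]
      rw [swap_apply_of_ne_of_ne]
      · exact hF
      all_goals (intro e; rw [e] at hF; simp at hF)
      omega
    rw [map_mul, map_mul, Perm.mul_apply, Perm.mul_apply, hg _ hi', ← Perm.mul_apply, ← map_mul]
    simp
  have hm12 : K π (m + 1) ≤ K π (m + 2) := K_mono (by omega)
  have := D.step (m := m + 1) (x := x) (y := y) (by omega) (by omega) hP ?_ hx2 ?_ yK hxy ?_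
  · exact ⟨this.1, x, this.2.1, hx, this.2.2⟩
  · intro i hi
    rw [hx]; apply ss_fix
    all_goals (rintro rfl; simp at hi)
  · rw [hx, Perm.mul_apply, swap_apply_left, swap_apply_of_ne_of_ne] <;> simp
  · intro k hk
    rcases hK k hk with h | ⟨a, ha, b, hb', rfl⟩
    · left; exact hm12 (hconj k h)
    · right
      refine ⟨x * a * x * y⁻¹, mul_mem (hm12 (hconj a ha)) (inv_mem yK),
        y⁻¹ * (x * b * x), mul_mem (inv_mem yK) (hm12 (hconj b hb')), ?_⟩
      have e : x * (a * y * b) * x = (x * a * x) * (x * y * x) * (x * b * x) := by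
        have e2 : ∀ u : H, x * (x * u) = u := fun u => by rw [← mul_assoc, hx2, one_mul]
        simp only [mul_assoc, e2]
      rw [e, hb]; simp only [mul_assoc]

lemma not_Inv (hn : 5 ≤ n) (hperf : commutator H = ⊤) : ¬ Inv π := by
  intro hI
  have hQ : ∀ m (hm2 : 2 ≤ m) (hm : m + 1 < n), Q π z m hn hm := by
    intro m hm2
    induction m, hm2 using Nat.le_induction with
    | base => intro hm; exact D.Q2 hn hI
    | succ m hm2 ih => intro hm; exact D.Qstep hn hI hm2 (by omega) (ih (by omega))
  have hP := (hQ (n - 2) (by omega) (by omega)).1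
  rw [show n - 2 + 2 = n by omega] at hP
  have hall : ∀ g, g ∈ K π n ∨ z * g ∈ K π n := fun g => hP.2 g (fun i hi => absurd i.2 (by omega))
  have : commutator H ≤ K π n := by
    rw [commutator_def, Subgroup.commutator_le]
    have hz1 : ∀ a b : H, ⁅z * a, b⁆ = ⁅a, b⁆ := by
      intro a b
      simp only [commutatorElement_def, mul_inv_rev]
      calc z * a * b * (a⁻¹ * z⁻¹) * b⁻¹ = z * (a * b * a⁻¹) * z⁻¹ * b⁻¹ := by group
        _ = a * b * a⁻¹ * b⁻¹ := by rw [D.comm]; group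
    have hz2 : ∀ a b : H, ⁅a, z * b⁆ = ⁅a, b⁆ := by
      intro a b
      rw [← commutatorElement_inv, hz1, commutatorElement_inv]
    have hcl : ∀ a ∈ K π n, ∀ b ∈ K π n, ⁅a, b⁆ ∈ K π n := by
      intro a ha b hb
      rw [commutatorElement_def]
      exact mul_mem (mul_mem (mul_mem ha hb) (inv_mem ha)) (inv_mem hb)
    intro a _ b _
    rcases hall a with ha | ha <;> rcases hall b with hb | hb
    · exact hcl _ ha _ hb
    · rw [← hz2]; exact hcl _ ha _ hb
    · rw [← hz1]; exact hcl _ ha _ hb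
    · rw [← hz1, ← hz2]; exact hcl _ ha _ hb
  rw [hperf] at this
  exact hP.1 (this (Subgroup.mem_top z))


lemma sq_eq {i j k l i' j' k' l' : Fin n} (h : [i, j, k, l].Nodup) (h' : [i', j', k', l'].Nodup)
    {a g : H} (ha : π a = swap i j * swap k l) (hg : π g = swap i' j' * swap k' l') :
    g * g = a * a := by
  have hc : IsConj (π a) (π g) := by
    rw [isConj_iff_cycleType_eq, ha, hg, cycleType_swap_mul_swap_of_nodup h,
      cycleType_swap_mul_swap_of_nodup h']
  obtain ⟨c, hc⟩ := isConj_iff.1 hc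
  have : ∃ c : Perm (Fin n), sign c = 1 ∧ c * π a * c⁻¹ = π g := by
    rcases Int.units_eq_one_or (sign c) with h1 | h1
    · exact ⟨c, h1, hc⟩
    · simp only [List.nodup_cons, List.mem_cons, not_or] at h
      refine ⟨c * swap i j, by rw [Perm.sign_mul, h1, sign_swap h.1.1]; rfl, ?_⟩
      have e : swap i j * π a * (swap i j)⁻¹ = π a := by
        rw [ha, mul_inv_eq_iff_eq_mul, mul_assoc (swap i j) (swap k l) (swap i j),
          swap_mul_swap_comm_aux h.1.2.1 h.1.2.2.1 h.2.1.1 h.2.1.2.1]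
      calc c * swap i j * π a * (c * swap i j)⁻¹ = c * (swap i j * π a * (swap i j)⁻¹) * c⁻¹ := by group
        _ = π g := by rw [e, hc]
  obtain ⟨c, hs, hc⟩ := this
  obtain ⟨u, rfl⟩ := D.lift c hs
  have e1 : (u * a * u⁻¹) * (u * a * u⁻¹) = a * a := by
    have e2 : π (a * a) = 1 := by
      rw [map_mul, ha]
      simp only [List.nodup_cons, List.mem_cons, not_or] at h
      rw [← mul_assoc, mul_assoc (swap i j) (swap k l) (swap i j),
          swap_mul_swap_comm_aux h.1.2.1 h.1.2.2.1 h.2.1.1 h.2.1.2.1, ← mul_assoc, swap_mul_self,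
          one_mul, swap_mul_self]
    have e3 : u * (a * a) = (a * a) * u := by
      rcases (D.ker _).1 e2 with h | h <;> rw [h]
      · simp
      · rw [D.comm]
    calc (u * a * u⁻¹) * (u * a * u⁻¹) = u * (a * a) * u⁻¹ := by group
      _ = a * a := by rw [e3]; group
  rcases D.eq_or (g := g) (k := u * a * u⁻¹) (by simpa using hc.symm) with h | h
  · rw [h, e1]
  · rw [h, D.zsq, e1]

omit D in
lemma v4 {p q r s : Fin n} (h : [p, q, r, s].Nodup) :
    (swap p q * swap r s) * (swap p r * swap q s) = swap p s * swap q r := by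
  simp only [List.nodup_cons, List.mem_cons, not_or] at h
  ext i
  simp only [Perm.mul_apply, swap_apply_def]
  grind

lemma anti (hn : 5 ≤ n) (hperf : commutator H = ⊤) {p q r s : Fin n} (h : [p, q, r, s].Nodup)
    {a b : H} (ha : π a = swap p q * swap r s) (hb : π b = swap p r * swap q s) :
    b * a = z * (a * b) := by
  have hN := D.not_Inv hn hperf
  have h1 : [p, r, q, s].Nodup := by simp at h ⊢; grind
  have h2 : [p, s, q, r].Nodup := by simp at h ⊢; grind
  have hab : π (a * b) = swap p s * swap q r := by rw [map_mul, ha, hb, v4 h]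
  have hba : π (b * a) = π (a * b) := by
    rw [hab, map_mul, ha, hb, v4 h1, swap_comm r q]
  rcases D.eq_or hba with hc | hc
  · exfalso
    apply hN
    have e1 := D.sq_eq h h1 ha hb
    have e2 := D.sq_eq h h2 ha hab
    have e3 : a * b * (a * b) = a * a * (b * b) := by
      rw [mul_assoc, ← mul_assoc b a b, hc]; simp only [mul_assoc]
    rw [e3, e1] at e2
    have e4 : a * a = 1 := by simpa using e2
    intro i j k l g hij hik hil hjk hjl hkl hg
    rw [D.sq_eq (i' := i) (j' := j) (k' := k) (l' := l) h (by simp; tauto) ha hg, e4]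
  · exact hc

/-- lifts of double transpositions commute with lifts of permutations fixing the four points -/
lemma disj {p q r s : Fin n} (h : [p, q, r, s].Nodup) {b w : H}
    (hb : π b = swap p r * swap q s) (hp : π w p = p) (hq : π w q = q) (hr : π w r = r)
    (hs : π w s = s) : b * w = w * b := by
  have h' := h
  simp only [List.nodup_cons, List.mem_cons, not_or] at h'
  obtain ⟨u, hu⟩ := D.lift (swap p q * swap q r) (sign_ss h'.1.1 h'.2.1.1)
  obtain ⟨v, hv⟩ := D.lift (swap p q * swap r s) (sign_ss h'.1.1 h'.2.2.1.1)
  have hc : ∀ i j : Fin n, π w i = i → π w j = j → π w * swap i j = swap i j * π w := by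
    intro i j hi hj
    rw [mul_swap_eq_swap_mul, hi, hj]
  have hcc : ∀ i j k l : Fin n, π w i = i → π w j = j → π w k = k → π w l = l → ∀ g,
      π g = swap i j * swap k l → ∃ e, (e = 1 ∨ e = z) ∧ w * g * w⁻¹ = e * g := by
    intro i j k l hi hj hk hl g hg
    have : π (w * g) = π (g * w) := by
      rw [map_mul, map_mul, hg, ← mul_assoc, hc i j hi hj, mul_assoc, hc k l hk hl, mul_assoc]
    rcases D.eq_or this with h | h
    · exact ⟨1, Or.inl rfl, by rw [h]; group⟩
    · exact ⟨z, Or.inr rfl, by rw [h]; group⟩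
  obtain ⟨e1, he1, hwu⟩ := hcc _ _ _ _ hp hq hq hr u hu
  obtain ⟨e2, he2, hwv⟩ := hcc _ _ _ _ hp hq hr hs v hv
  have hz1 : ∀ a b : H, ⁅z * a, b⁆ = ⁅a, b⁆ := by
    intro a b
    simp only [commutatorElement_def, mul_inv_rev]
    calc z * a * b * (a⁻¹ * z⁻¹) * b⁻¹ = z * (a * b * a⁻¹) * z⁻¹ * b⁻¹ := by group
      _ = a * b * a⁻¹ * b⁻¹ := by rw [D.comm]; group
  have hz2 : ∀ a b : H, ⁅a, z * b⁆ = ⁅a, b⁆ := by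
    intro a b
    rw [← commutatorElement_inv, hz1, commutatorElement_inv]
  have hw : w * ⁅u, v⁆ * w⁻¹ = ⁅u, v⁆ := by
    rw [conjugate_commutatorElement, hwu, hwv]
    rcases he1 with rfl | rfl <;> rcases he2 with rfl | rfl <;> simp [hz1, hz2]
  have hw' : w * ⁅u, v⁆ = ⁅u, v⁆ * w := by rwa [mul_inv_eq_iff_eq_mul] at hw
  have huv : π ⁅u, v⁆ = swap p r * swap q s := by
    rw [map_commutatorElement, commutatorElement_def, mul_inv_eq_iff_eq_mul, mul_inv_eq_iff_eq_mul,
      hv]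
    have up : π u p = q := by
      rw [hu, Perm.mul_apply, swap_apply_of_ne_of_ne h'.1.1 h'.1.2.1, swap_apply_left]
    have uq : π u q = r := by
      rw [hu, Perm.mul_apply, swap_apply_left, swap_apply_of_ne_of_ne (Ne.symm h'.1.2.1)
        (Ne.symm h'.2.1.1)]
    have ur : π u r = p := by
      rw [hu, Perm.mul_apply, swap_apply_right, swap_apply_right]
    have us : π u s = s := by
      rw [hu]
      exact ss_fix (Ne.symm h'.1.2.2.1) (Ne.symm h'.2.1.2.1) (Ne.symm h'.2.1.2.1)
        (Ne.symm h'.2.2.1.1)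
    have h1 : [p, r, q, s].Nodup := by simp at h ⊢; grind
    rw [← mul_assoc, mul_swap_eq_swap_mul (π u) p q, up, uq, mul_assoc (swap q r),
      mul_swap_eq_swap_mul (π u) r s, ur, us, ← mul_assoc (swap q r), v4 h1, swap_comm r q,
      swap_mul_swap_comm_aux h'.1.1 h'.1.2.1 (Ne.symm h'.2.1.2.1) (Ne.symm h'.2.2.1.1)]
  rcases D.eq_or (hb.trans huv.symm) with h | h
  · rw [h, hw']
  · rw [h, mul_assoc, ← hw', ← mul_assoc, ← mul_assoc, D.comm]

end DC

/-- the i-th block -/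
def blk (n i : ℕ) : Perm (Fin n) :=
  if h : 4 * i + 3 < n then
    swap ⟨4 * i, by omega⟩ ⟨4 * i + 1, by omega⟩ * swap ⟨4 * i + 2, by omega⟩ ⟨4 * i + 3, h⟩
  else 1

lemma blk_sign (n i : ℕ) : sign (blk n i) = 1 := by
  unfold blk
  split_ifs
  · exact DC.sign_ss (by simp) (by simp)
  · simp

lemma blk_fix (n i : ℕ) (hi : 1 ≤ i) (x : Fin n) (hx : x.1 < 4) : blk n i x = x := by
  unfold blk
  split_ifs
  · apply DC.ss_fix <;> (intro h; have := congrArg Fin.val h; simp at this; omega)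
  · simp

lemma rest (n : ℕ) (l : List ℕ) (hl : ∀ i ∈ l, 1 ≤ i) :
    sign (l.map (blk n)).prod = 1 ∧ ∀ x : Fin n, x.1 < 4 → (l.map (blk n)).prod x = x := by
  induction l with
  | nil => simp
  | cons a l ih =>
    have ih := ih (fun i hi => hl i (List.mem_cons_of_mem _ hi))
    rw [List.map_cons, List.prod_cons]
    refine ⟨by rw [Perm.sign_mul, blk_sign, ih.1, one_mul], fun x hx => ?_⟩
    rw [Perm.mul_apply, ih.2 x hx, blk_fix n a (hl a (by simp)) x hx]

end DCov



theorem stmt_14 (n r : ℕ) (hn : 5 ≤ n) (hr : 1 ≤ r) (hrn : 4 * r ≤ n)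
    (H : Type*) [Group H] [Finite H] (hperf : commutator H = ⊤)
    (Z : Subgroup H) (hZc : Z ≤ Subgroup.center H) (hZ2 : Nat.card Z = 2)
    (π : H →* Equiv.Perm (Fin n)) (hπrange : π.range = alternatingGroup (Fin n))
    (hπker : π.ker = Z)
    (ζ : Equiv.Perm (Fin n))
    (hζ : ζ = ((List.range r).attach.map (fun i =>
        Equiv.swap (⟨4 * i.1, by have := List.mem_range.mp i.2; omega⟩ : Fin n)
            ⟨4 * i.1 + 1, by have := List.mem_range.mp i.2; omega⟩ *
          Equiv.swap (⟨4 * i.1 + 2, by have := List.mem_range.mp i.2; omega⟩ : Fin n)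
            ⟨4 * i.1 + 3, by have := List.mem_range.mp i.2; omega⟩)).prod)
    (h : H) (hh : π h = ζ) :
    Nat.card {x : H // x * h = h * x} =
      Nat.card {σ : alternatingGroup (Fin n) //
        (σ : Equiv.Perm (Fin n)) * ζ = ζ * (σ : Equiv.Perm (Fin n))} := by
  classical
  obtain ⟨z, hz⟩ : ∃ z : H, z ≠ 1 ∧ ∀ g, g ∈ Z ↔ g = 1 ∨ g = z := by
    obtain ⟨x, y, hxy, hu⟩ := Nat.card_eq_two_iff.1 hZ2
    have hmem : ∀ g (hg : g ∈ Z), (⟨g, hg⟩ : Z) = x ∨ (⟨g, hg⟩ : Z) = y := by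
      intro g hg
      have : (⟨g, hg⟩ : Z) ∈ ({x, y} : Set Z) := by rw [hu]; trivial
      simpa using this
    rcases hmem 1 (one_mem _) with h1 | h1
    · refine ⟨y, ?_, fun g => ⟨fun hg => ?_, ?_⟩⟩
      · intro e; apply hxy; rw [← h1]; exact Subtype.ext e.symm
      · rcases hmem g hg with h | h
        · left; rw [← h1] at h; exact congrArg Subtype.val h
        · right; exact congrArg Subtype.val h
      · rintro (rfl | rfl)
        · exact one_mem _
        · exact y.2
    · refine ⟨x, ?_, fun g => ⟨fun hg => ?_, ?_⟩⟩
      · intro e; apply hxy; rw [← h1]; exact Subtype.ext e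
      · rcases hmem g hg with h | h
        · right; exact congrArg Subtype.val h
        · left; rw [← h1] at h; exact congrArg Subtype.val h
      · rintro (rfl | rfl)
        · exact one_mem _
        · exact x.2
  obtain ⟨hz1, hzZ⟩ := hz
  have hzm : z ∈ Z := (hzZ z).2 (Or.inr rfl)
  have D : DCov.DC π z :=
    { ne := hz1
      sq := by
        rcases (hzZ _).1 (mul_mem hzm hzm) with h | h
        · exact h
        · exact absurd (by simpa using h) hz1
      comm := fun g => ((Subgroup.mem_center_iff.1 (hZc hzm)) g).symm
      ker := fun g => by rw [← hzZ, ← hπker, MonoidHom.mem_ker]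
      sgn := fun g => by
        rw [← Equiv.Perm.mem_alternatingGroup, ← hπrange]; exact ⟨g, rfl⟩
      lift := fun σ hσ => by
        rw [← Equiv.Perm.mem_alternatingGroup, ← hπrange] at hσ; exact hσ }
  have h0 : 0 < n := by omega
  have h1 : 1 < n := by omega
  have h2 : 2 < n := by omega
  have h3 : 3 < n := by omega
  have hζ' : ζ = ((List.range r).map (DCov.blk n)).prod := by
    rw [hζ, ← List.attach_map_val (l := List.range r) (f := DCov.blk n)]
    congr 1
    apply List.map_congr_left
    intro i _
    have := List.mem_range.mp i.2
    rw [DCov.blk, dif_pos (by omega)]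
  obtain ⟨s, rfl⟩ : ∃ s, r = s + 1 := ⟨r - 1, by omega⟩
  rw [List.range_succ_eq_map, List.map_cons, List.prod_cons] at hζ'
  obtain ⟨hs1, hs2⟩ := DCov.rest n (List.map Nat.succ (List.range s)) (by simp)
  generalize ((List.map Nat.succ (List.range s)).map (DCov.blk n)).prod = ζr at hζ' hs1 hs2
  obtain ⟨a, ha⟩ := D.lift _ (DCov.blk_sign n 0)
  obtain ⟨w, hw⟩ := D.lift ζr hs1
  have ha' : π a = Equiv.swap ⟨0, h0⟩ ⟨1, h1⟩ * Equiv.swap ⟨2, h2⟩ ⟨3, h3⟩ := by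
    rw [ha, DCov.blk, dif_pos (by omega)]
  obtain ⟨b, hb⟩ := D.lift (Equiv.swap ⟨0, h0⟩ ⟨2, h2⟩ * Equiv.swap ⟨1, h1⟩ ⟨3, h3⟩)
    (DCov.DC.sign_ss (by simp) (by simp))
  have hnd : [(⟨0, h0⟩ : Fin n), ⟨1, h1⟩, ⟨2, h2⟩, ⟨3, h3⟩].Nodup := by simp
  have hba := D.anti hn hperf hnd ha' hb
  have hbw := D.disj hnd hb (w := w) (by rw [hw]; exact hs2 _ (by simp))
    (by rw [hw]; exact hs2 _ (by simp)) (by rw [hw]; exact hs2 _ (by simp))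
    (by rw [hw]; exact hs2 _ (by simp))
  have hbaw : b * (a * w) = z * ((a * w) * b) := by
    rw [← mul_assoc, hba, mul_assoc, mul_assoc a b w, hbw, mul_assoc a w b]
  have hbh : b * h = z * (h * b) := by
    rcases D.eq_or (g := h) (k := a * w) (by rw [hh, map_mul, ha, hw, hζ']) with e | e
    · rw [e, hbaw]
    · rw [e, ← mul_assoc, ← D.comm, mul_assoc z b, hbaw, mul_assoc z (a * w) b]
  clear hbaw hbw hba hnd ha' hb
  -- counting
  let C : Subgroup H := Subgroup.centralizer {h}
  let E : Subgroup H := (Subgroup.centralizer {ζ}).comap π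
  have hC : ∀ x, x ∈ C ↔ h * x = x * h := fun x => by
    simp only [C, Subgroup.mem_centralizer_singleton_iff]
    first | rfl | exact eq_comm
  have hE : ∀ x, x ∈ E ↔ ζ * π x = π x * ζ := fun x => by
    simp only [E, Subgroup.mem_comap, Subgroup.mem_centralizer_singleton_iff]
    first | rfl | exact eq_comm
  have hEz : ∀ x, x ∈ E → x * h = h * x ∨ x * h = z * (h * x) := by
    intro x hx
    rw [hE] at hx
    exact D.eq_or (by rw [map_mul, map_mul, hh, hx])
  have hCE : C ≤ E := by
    intro x hx
    rw [hC] at hx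
    rw [hE, ← hh, ← map_mul, hx, map_mul]
  have hbE : b ∈ E := by
    rw [hE, ← hh, ← map_mul, ← map_mul, hbh, map_mul π z, D.pz, one_mul]
  have hidx : C.relIndex E = 2 := by
    rw [Subgroup.relIndex_eq_two_iff]
    refine ⟨b, hbE, fun x hx => ?_⟩
    rw [hC, hC]
    have hne : ∀ y : H, z * y ≠ y := fun y e => hz1 (by simpa using e)
    have e1 : x * b * h = z * (x * h * b) := by
      rw [mul_assoc, hbh, ← mul_assoc, ← D.comm, mul_assoc, mul_assoc x h b]
    rcases hEz x hx with e | e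
    · right
      refine ⟨e.symm, ?_⟩
      rw [e1, e, ← mul_assoc h x b]
      exact fun e => hne _ e.symm
    · left
      rw [e1, e, mul_assoc z (h * x) b, D.zz, mul_assoc h x b]
      exact ⟨rfl, fun e => hne _ e.symm⟩
  have hcard1 : Nat.card E = Nat.card C * 2 := by
    rw [← hidx, ← Subgroup.relIndex_bot_left, ← Subgroup.relIndex_bot_left,
      Subgroup.relIndex_mul_relIndex _ _ _ bot_le hCE]
  let f : E →* Equiv.Perm (Fin n) := π.comp E.subtype
  have hZE : Z ≤ E := by
    intro x hx
    rw [← hπker, MonoidHom.mem_ker] at hx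
    rw [hE, hx]; simp
  have hkerf : Nat.card f.ker = 2 := by
    have : f.ker = Z.subgroupOf E := by
      ext x
      rw [← hπker]; rfl
    rw [this, Nat.card_congr (Subgroup.subgroupOfEquivOfLe hZE).toEquiv, hZ2]
  have hcard2 : Nat.card E = 2 * Nat.card f.range := by
    rw [← Subgroup.index_ker, ← hkerf, Subgroup.card_mul_index]
  have hrange : Nat.card f.range = Nat.card {σ : alternatingGroup (Fin n) //
        (σ : Equiv.Perm (Fin n)) * ζ = ζ * (σ : Equiv.Perm (Fin n))} := by
    refine Nat.card_congr
      { toFun := fun σ => ⟨⟨σ.1, ?_⟩, ?_⟩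
        invFun := fun σ => ⟨σ.1.1, ?_⟩
        left_inv := fun σ => rfl
        right_inv := fun σ => rfl }
    · obtain ⟨x, hx⟩ := σ.2
      rw [← hx, ← hπrange]; exact ⟨x.1, rfl⟩
    · obtain ⟨x, hx⟩ := σ.2
      have := (hE x.1).1 x.2
      show σ.1 * ζ = ζ * σ.1
      rw [← hx]; exact this.symm
    · obtain ⟨x, hx⟩ : σ.1.1 ∈ π.range := by rw [hπrange]; exact σ.1.2
      exact ⟨⟨x, by rw [hE, hx]; exact σ.2.symm⟩, hx⟩
  have hCc : Nat.card {x : H // x * h = h * x} = Nat.card C :=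
    Nat.card_congr (Equiv.subtypeEquivRight fun x => by rw [hC]; exact eq_comm)
  rw [hCc, ← hrange]
  omega
end
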